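/- If a state τ ∈ Ω has a green horizontal bridge, then τ has no red vertical bridge. -/

import Mathlib

open Finset

/-! Six-vertex model on the `n × n` square lattice region `Λ_n` with free
boundary conditions.

`Edge.horiz k j` is the horizontal edge between `x = k-1` and `x = k` at
height `j`; `Edge.vert i k` is the vertical edge between `y = k-1` and
`y = k` on column `i`.  The vertices of `Λ_n` are the pairs
`(i, j) : Fin n × Fin n`.  An edge configuration assigns `true`
(rightwards / upwards) or `false` (leftwards / downwards) to every edge. -/
inductive Edge (n : ℕ) : Type
  | horiz (k : Fin (n + 1)) (j : Fin n) : Edge n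
  | vert (i : Fin n) (k : Fin (n + 1)) : Edge n
  deriving DecidableEq, Fintype

abbrev EdgeConfig (n : ℕ) := Edge n → Bool

/-- The four edges incident to the vertex `(i, j)` of `Λ_n`. -/
def leftE {n : ℕ} (i j : Fin n) : Edge n := Edge.horiz i.castSucc j
def rightE {n : ℕ} (i j : Fin n) : Edge n := Edge.horiz i.succ j
def botE {n : ℕ} (i j : Fin n) : Edge n := Edge.vert i j.castSucc
def topE {n : ℕ} (i j : Fin n) : Edge n := Edge.vert i j.succ

/-- The in-degree of the vertex `(i, j)` in the configuration `τ`. -/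
def inDegree {n : ℕ} (τ : EdgeConfig n) (i j : Fin n) : ℕ :=
  (cond (τ (leftE i j)) 1 0) + (cond (τ (rightE i j)) 0 1) +
    (cond (τ (botE i j)) 1 0) + (cond (τ (topE i j)) 0 1)

/-- The ice rule: every vertex has exactly two incoming (and hence two
outgoing) incident edges; such a configuration is an Eulerian orientation. -/
def IceRule {n : ℕ} (τ : EdgeConfig n) : Prop :=
  ∀ i j : Fin n, inDegree τ i j = 2

instance {n : ℕ} (τ : EdgeConfig n) : Decidable (IceRule τ) :=
  inferInstanceAs (Decidable (∀ i j : Fin n, inDegree τ i j = 2))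

/-- `Ω`, the state space: all Eulerian orientations of `Λ_n`. -/
def OmegaSet (n : ℕ) : Set (EdgeConfig n) := {τ | IceRule τ}

/-- The state `τ_G`, in which every vertex has six-vertex type `c`. -/
def greenOrient {n : ℕ} : Edge n → Bool
  | Edge.horiz k j => (k.val + j.val) % 2 == 0
  | Edge.vert i k => (i.val + k.val) % 2 == 1

def tauG (n : ℕ) : EdgeConfig n := greenOrient

/-- The state `τ_R`, the total edge reversal of `τ_G`. -/
def tauR (n : ℕ) : EdgeConfig n := fun e => !(greenOrient e)

/-- An edge is green in `τ` if it is oriented as in `τ_G`, red otherwise. -/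
def greenB {n : ℕ} (τ : EdgeConfig n) (e : Edge n) : Bool := τ e == greenOrient e

def IsGreen {n : ℕ} (τ : EdgeConfig n) (e : Edge n) : Prop := τ e = greenOrient e
def IsRed {n : ℕ} (τ : EdgeConfig n) (e : Edge n) : Prop := τ e = !(greenOrient e)

/-- Incidence between edges and vertices of `Λ_n`. -/
def EdgeIncident {n : ℕ} : Edge n → Fin n × Fin n → Prop
  | Edge.horiz k j', (i, j) => j' = j ∧ (k = i.castSucc ∨ k = i.succ)
  | Edge.vert i' k, (i, j) => i' = i ∧ (k = j.castSucc ∨ k = j.succ)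

/-- Two (distinct) edges are adjacent if they share an incident `Λ_n`-vertex. -/
def EdgeAdj {n : ℕ} (e f : Edge n) : Prop :=
  e ≠ f ∧ ∃ v : Fin n × Fin n, EdgeIncident e v ∧ EdgeIncident f v

/-- A simple (self-avoiding) monochromatic path of edges of colour `g`
(`true` = green, `false` = red). -/
def MonoPath {n : ℕ} (τ : EdgeConfig n) (g : Bool) (p : List (Edge n)) : Prop :=
  p ≠ [] ∧ p.Nodup ∧ List.Chain' EdgeAdj p ∧ ∀ e ∈ p, greenB τ e = g

/-- A horizontal monochromatic bridge: a simple monochromatic path from a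
horizontal edge on the left boundary to a horizontal edge on the right
boundary of `Λ_n`. -/
def IsHorizBridge {n : ℕ} (τ : EdgeConfig n) (g : Bool) (p : List (Edge n)) : Prop :=
  MonoPath τ g p ∧ (∃ j, p.head? = some (Edge.horiz 0 j)) ∧
    (∃ j, p.getLast? = some (Edge.horiz (Fin.last n) j))

/-- A vertical monochromatic bridge, from the top boundary to the bottom. -/
def IsVertBridge {n : ℕ} (τ : EdgeConfig n) (g : Bool) (p : List (Edge n)) : Prop :=
  MonoPath τ g p ∧ (∃ i, p.head? = some (Edge.vert i (Fin.last n))) ∧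
    (∃ i, p.getLast? = some (Edge.vert i 0))

def HorizGreenBridge {n : ℕ} (τ : EdgeConfig n) : Prop := ∃ p, IsHorizBridge τ true p
def HorizRedBridge {n : ℕ} (τ : EdgeConfig n) : Prop := ∃ p, IsHorizBridge τ false p
def VertGreenBridge {n : ℕ} (τ : EdgeConfig n) : Prop := ∃ p, IsVertBridge τ true p
def VertRedBridge {n : ℕ} (τ : EdgeConfig n) : Prop := ∃ p, IsVertBridge τ false p

def HasGreenCross {n : ℕ} (τ : EdgeConfig n) : Prop :=
  HorizGreenBridge τ ∧ VertGreenBridge τ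

def HasRedCross {n : ℕ} (τ : EdgeConfig n) : Prop :=
  HorizRedBridge τ ∧ VertRedBridge τ

/-- `C_G`: the states with a green cross. -/
def CG (n : ℕ) : Set (EdgeConfig n) := {τ | IceRule τ ∧ HasGreenCross τ}

/-- `C_R`: the states with a red cross. -/
def CR (n : ℕ) : Set (EdgeConfig n) := {τ | IceRule τ ∧ HasRedCross τ}

/-! The shifted lattice `L = ℤ² + (1/2, 1/2)`, restricted to the region inside
`Λ_n`.  The `L_n`-vertex `(i, j) : Fin (n+1) × Fin (n+1)` represents the point
`(i - 1/2, j - 1/2)`; its boundary vertices are those with a coordinate equal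
to `0` or `n`.  An `L_n`-edge is a diagonal passing through exactly one
`Λ_n`-vertex; it is recorded as that `Λ_n`-vertex together with a Boolean
(`true` for the NE–SW diagonal, `false` for the NW–SE diagonal). -/
abbrev LVertex (n : ℕ) := Fin (n + 1) × Fin (n + 1)

abbrev LEdge (n : ℕ) := (Fin n × Fin n) × Bool

/-- The two `L_n`-endpoints of an `L_n`-edge. -/
def lEdgeEnds {n : ℕ} : LEdge n → LVertex n × LVertex n
  | ((i, j), true) => ((i.castSucc, j.castSucc), (i.succ, j.succ))
  | ((i, j), false) => ((i.succ, j.castSucc), (i.castSucc, j.succ))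

/-- The `L_n`-edge `e` joins the `L_n`-vertices `u` and `v`. -/
def StepOnEdge {n : ℕ} (e : LEdge n) (u v : LVertex n) : Prop :=
  lEdgeEnds e = (u, v) ∨ lEdgeEnds e = (v, u)

/-- Adjacency in the lattice `L_n`. -/
def LAdjacent {n : ℕ} (u v : LVertex n) : Prop :=
  ∃ e : LEdge n, StepOnEdge e u v

/-- Membership of an `L_n`-edge in `L_τ`: the four `Λ_n`-edges incident to the
`Λ_n`-vertex it passes through are two green and two red, and the edge
separates the two green edges from the two red ones. -/
def lTau {n : ℕ} (τ : EdgeConfig n) : LEdge n → Bool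
  | ((i, j), true) =>
      (greenB τ (leftE i j) == greenB τ (topE i j)) &&
        (greenB τ (rightE i j) == greenB τ (botE i j)) &&
        !(greenB τ (leftE i j) == greenB τ (rightE i j))
  | ((i, j), false) =>
      (greenB τ (leftE i j) == greenB τ (botE i j)) &&
        (greenB τ (rightE i j) == greenB τ (topE i j)) &&
        !(greenB τ (leftE i j) == greenB τ (rightE i j))

/-- A step between two `L_n`-vertices along an edge of `L_τ`. -/
def LStep {n : ℕ} (τ : EdgeConfig n) (u v : LVertex n) : Prop :=
  ∃ e : LEdge n, StepOnEdge e u v ∧ lTau τ e = true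

/-- The consecutive steps of a path given as a list of vertices. -/
def pathSteps {α : Type*} (p : List α) : List (α × α) := p.zip p.tail

/-- A vertical fault line: a self-avoiding path of `L_τ`-edges from an
`L_n`-vertex on the top boundary to an `L_n`-vertex on the bottom boundary. -/
def IsVertFaultLine {n : ℕ} (τ : EdgeConfig n) (p : List (LVertex n)) : Prop :=
  p ≠ [] ∧ p.Nodup ∧ List.Chain' (LStep τ) p ∧
    (∃ u, p.head? = some u ∧ u.2 = Fin.last n) ∧
    (∃ u, p.getLast? = some u ∧ u.2 = 0)

/-- A horizontal fault line: from the left boundary to the right boundary. -/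
def IsHorizFaultLine {n : ℕ} (τ : EdgeConfig n) (p : List (LVertex n)) : Prop :=
  p ≠ [] ∧ p.Nodup ∧ List.Chain' (LStep τ) p ∧
    (∃ u, p.head? = some u ∧ u.1 = 0) ∧
    (∃ u, p.getLast? = some u ∧ u.1 = Fin.last n)

def HasVertFaultLine {n : ℕ} (τ : EdgeConfig n) : Prop := ∃ p, IsVertFaultLine τ p
def HasHorizFaultLine {n : ℕ} (τ : EdgeConfig n) : Prop := ∃ p, IsHorizFaultLine τ p

/-- `C_FL`: the states with a (horizontal or vertical) fault line. -/
def CFL (n : ℕ) : Set (EdgeConfig n) :=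
  {τ | IceRule τ ∧ (HasHorizFaultLine τ ∨ HasVertFaultLine τ)}

/-- A vertical almost fault line: a self-avoiding `L_n`-path from the top
boundary to the bottom boundary all of whose edges except exactly one
belong to `L_τ`. -/
def IsVertAlmostFaultLine {n : ℕ} (τ : EdgeConfig n) (p : List (LVertex n)) : Prop :=
  p ≠ [] ∧ p.Nodup ∧ List.Chain' LAdjacent p ∧
    (∃ u, p.head? = some u ∧ u.2 = Fin.last n) ∧
    (∃ u, p.getLast? = some u ∧ u.2 = 0) ∧
    ∃ s ∈ pathSteps p, ¬ LStep τ s.1 s.2 ∧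
      ∀ t ∈ pathSteps p, t ≠ s → LStep τ t.1 t.2

/-- A horizontal almost fault line. -/
def IsHorizAlmostFaultLine {n : ℕ} (τ : EdgeConfig n) (p : List (LVertex n)) : Prop :=
  p ≠ [] ∧ p.Nodup ∧ List.Chain' LAdjacent p ∧
    (∃ u, p.head? = some u ∧ u.1 = 0) ∧
    (∃ u, p.getLast? = some u ∧ u.1 = Fin.last n) ∧
    ∃ s ∈ pathSteps p, ¬ LStep τ s.1 s.2 ∧
      ∀ t ∈ pathSteps p, t ≠ s → LStep τ t.1 t.2

/-- `C_AFL`: the states with an almost fault line. -/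
def CAFL (n : ℕ) : Set (EdgeConfig n) :=
  {τ | IceRule τ ∧
    ((∃ p, IsHorizAlmostFaultLine τ p) ∨ (∃ p, IsVertAlmostFaultLine τ p))}

/-- The weight of the vertex `(i, j)`: `c` for the two `c`-type configurations
(both horizontal edges in, or both out), and `a` or `b` for the others. -/
noncomputable def vertexWeight {n : ℕ} (a b c : ℝ) (τ : EdgeConfig n)
    (i j : Fin n) : ℝ :=
  if τ (leftE i j) ≠ τ (rightE i j) then c
  else if τ (leftE i j) = τ (botE i j) then a else b

/-- The weight `w(τ)` of a state: the product of the vertex weights. -/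
noncomputable def weight {n : ℕ} (a b c : ℝ) (τ : EdgeConfig n) : ℝ :=
  ∏ v : Fin n × Fin n, vertexWeight a b c τ v.1 v.2

/-- The partition function `Z`. -/
noncomputable def Zsum (n : ℕ) (a b c : ℝ) : ℝ :=
  ∑ τ ∈ Finset.univ.filter (fun τ : EdgeConfig n => IceRule τ), weight a b c τ

open Classical in
/-- The Gibbs measure of a set of states, `π(S) = (Σ_{τ∈S} w(τ))/Z`. -/
noncomputable def piSet (n : ℕ) (a b c : ℝ) (S : Set (EdgeConfig n)) : ℝ :=
  (∑ τ ∈ Finset.univ.filter (fun τ : EdgeConfig n => τ ∈ S), weight a b c τ) /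
    Zsum n a b c

/-- The four edges (bottom, right, top, left) of the unit square of `ℤ²`
whose lower-left corner is the `Λ_n`-vertex `(i, j)`. -/
def squareEdges (n : ℕ) (i j : ℕ) (hi : i + 1 < n) (hj : j + 1 < n) :
    Edge n × Edge n × Edge n × Edge n :=
  (Edge.horiz ⟨i + 1, by omega⟩ ⟨j, by omega⟩,
    Edge.vert ⟨i + 1, by omega⟩ ⟨j + 1, by omega⟩,
    Edge.horiz ⟨i + 1, by omega⟩ ⟨j + 1, by omega⟩,
    Edge.vert ⟨i, by omega⟩ ⟨j + 1, by omega⟩)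

/-- The four edges (bottom, right, top, left) around a unit square form a
directed cycle, i.e. are consistently oriented. -/
def DirectedSquare {n : ℕ} (τ : EdgeConfig n)
    (e : Edge n × Edge n × Edge n × Edge n) : Prop :=
  (τ e.1 = true ∧ τ e.2.1 = true ∧ τ e.2.2.1 = false ∧ τ e.2.2.2 = false) ∨
    (τ e.1 = false ∧ τ e.2.1 = false ∧ τ e.2.2.1 = true ∧ τ e.2.2.2 = true)

/-- Reversing the orientations of the four edges around a unit square. -/
def flipSquare {n : ℕ} (τ : EdgeConfig n)
    (e : Edge n × Edge n × Edge n × Edge n) : EdgeConfig n :=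
  fun f => if f = e.1 ∨ f = e.2.1 ∨ f = e.2.2.1 ∨ f = e.2.2.2 then !(τ f) else τ f

/-- A move of the Glauber dynamics `M_G` at the unit square with lower-left
corner `(i, j)`: the four edges around the square are consistently oriented
in `τ`, and `τ'` is obtained from `τ` by reversing them. -/
def GlauberMoveAt {n : ℕ} (τ τ' : EdgeConfig n) (i j : ℕ)
    (hi : i + 1 < n) (hj : j + 1 < n) : Prop :=
  DirectedSquare τ (squareEdges n i j hi hj) ∧
    τ' = flipSquare τ (squareEdges n i j hi hj)

/-- A move of the Glauber dynamics `M_G`. -/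
def GlauberMove {n : ℕ} (τ τ' : EdgeConfig n) : Prop :=
  ∃ (i j : ℕ) (hi : i + 1 < n) (hj : j + 1 < n), GlauberMoveAt τ τ' i j hi hj

/-- `∂C_G`: the states outside `C_G` that are one move of `M_G` away from
`C_G`. -/
def boundaryCG (n : ℕ) : Set (EdgeConfig n) :=
  {τ | IceRule τ ∧ τ ∉ CG n ∧ ∃ σ ∈ CG n, GlauberMove σ τ}

/-- The state space `Ω` as a type. -/
abbrev OmegaT (n : ℕ) := {τ : EdgeConfig n // IceRule τ}

open Classical in
/-- Metropolis transition rate of `M_G` between two distinct states: propose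
one of the `(n-1)²` unit squares uniformly at random and accept the flip with
probability `min 1 (w(τ')/w(τ))`. -/
noncomputable def metro {n : ℕ} (a b c : ℝ) (τ τ' : OmegaT n) : ℝ :=
  if GlauberMove τ.1 τ'.1 then
    (1 / (((n : ℝ) - 1) * ((n : ℝ) - 1))) *
      min 1 (weight a b c τ'.1 / weight a b c τ.1)
  else 0

/-- The transition matrix of the Glauber dynamics `M_G`. -/
noncomputable def transP {n : ℕ} (a b c : ℝ) (τ τ' : OmegaT n) : ℝ :=
  if τ' = τ then 1 - ∑ σ ∈ Finset.univ.erase τ, metro a b c τ σ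
  else metro a b c τ τ'

/-- The `t`-step transition probabilities of `M_G`. -/
noncomputable def transPow {n : ℕ} (a b c : ℝ) : ℕ → OmegaT n → OmegaT n → ℝ
  | 0, τ, τ' => if τ = τ' then 1 else 0
  | t + 1, τ, τ' => ∑ σ : OmegaT n, transPow a b c t τ σ * transP a b c σ τ'

/-- The stationary Gibbs distribution `π` on `Ω`. -/
noncomputable def piDist {n : ℕ} (a b c : ℝ) (τ : OmegaT n) : ℝ :=
  weight a b c τ.1 / Zsum n a b c

/-- Total variation distance between two distributions on `Ω`. -/
noncomputable def tvDist {n : ℕ} (μ ν : OmegaT n → ℝ) : ℝ :=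
  (∑ τ : OmegaT n, |μ τ - ν τ|) / 2

/-- The mixing time of `M_G`: the smallest `t` after which the total variation
distance to `π` is at most `1/4` from any starting state. -/
noncomputable def mixingTime (n : ℕ) (a b c : ℝ) : ℕ :=
  sInf {t : ℕ | ∀ τ₀ : OmegaT n,
    tvDist (transPow a b c t τ₀) (piDist a b c) ≤ 1 / 4}

/-- The number of green edges incident to the vertex `(i, j)` in `τ`. -/
def greenCountAt {n : ℕ} (τ : EdgeConfig n) (i j : Fin n) : ℕ :=
  (cond (greenB τ (leftE i j)) 1 0) + (cond (greenB τ (rightE i j)) 1 0) +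
    (cond (greenB τ (botE i j)) 1 0) + (cond (greenB τ (topE i j)) 1 0)

/-- The number of `L_τ`-edges incident to the `L_n`-vertex `u`. -/
def lTauDegree {n : ℕ} (τ : EdgeConfig n) (u : LVertex n) : ℕ :=
  (Finset.univ.filter (fun e : LEdge n =>
    lTau τ e = true ∧ ((lEdgeEnds e).1 = u ∨ (lEdgeEnds e).2 = u))).card

/-- The number of colour changes encountered when going rotationally
(bottom, right, top, left) around the four `Λ_n`-edges surrounding the
internal `L_n`-vertex `(i, j)` (representing the point `(i - 1/2, j - 1/2)`). -/
def colorChangesAround (n : ℕ) (τ : EdgeConfig n) (i j : ℕ)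
    (hi0 : 0 < i) (hin : i < n) (hj0 : 0 < j) (hjn : j < n) : ℕ :=
  let bo := greenB τ (Edge.horiz ⟨i, by omega⟩ ⟨j - 1, by omega⟩)
  let t := greenB τ (Edge.horiz ⟨i, by omega⟩ ⟨j, by omega⟩)
  let l := greenB τ (Edge.vert ⟨i - 1, by omega⟩ ⟨j, by omega⟩)
  let r := greenB τ (Edge.vert ⟨i, by omega⟩ ⟨j, by omega⟩)
  (cond (bo != r) 1 0) + (cond (r != t) 1 0) +
    (cond (t != l) 1 0) + (cond (l != bo) 1 0)

/-- The sum of a `ZMod 2`-valued edge function over the four edges at the vertex `v`. -/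
def vertexSum {n : ℕ} (c : Edge n → ZMod 2) (v : Fin n × Fin n) : ZMod 2 :=
  c (leftE v.1 v.2) + c (rightE v.1 v.2) + c (botE v.1 v.2) + c (topE v.1 v.2)

lemma vertexSum_add {n : ℕ} (c d : Edge n → ZMod 2) (v : Fin n × Fin n) :
    vertexSum (c + d) v = vertexSum c v + vertexSum d v := by
  simp only [vertexSum, Pi.add_apply]; ring

lemma vertexSum_single {n : ℕ} {e : Edge n} {v w : Fin n × Fin n} (hv : EdgeIncident e v)
    (hw : EdgeIncident e w) (hvw : v ≠ w) (u : Fin n × Fin n) :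
    vertexSum (Pi.single e 1) u = (if u = v then 1 else 0) + (if u = w then 1 else 0) := by
  obtain ⟨a, b⟩ := u
  obtain ⟨i, j⟩ := v
  obtain ⟨i', j'⟩ := w
  cases e with
  | horiz k l =>
    obtain ⟨rfl, hk⟩ := hv
    obtain ⟨rfl, hk'⟩ := hw
    simp only [vertexSum, leftE, rightE, botE, topE, Pi.single_apply, Edge.horiz.injEq,
      reduceCtorEq, if_false, add_zero, Prod.mk.injEq, and_true, Fin.ext_iff, Fin.val_castSucc,
      Fin.val_succ, ne_eq] at *
    split_ifs <;> first | omega | decide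
  | vert l k =>
    obtain ⟨rfl, hk⟩ := hv
    obtain ⟨rfl, hk'⟩ := hw
    simp only [vertexSum, leftE, rightE, botE, topE, Pi.single_apply, Edge.vert.injEq,
      reduceCtorEq, if_false, zero_add, Prod.mk.injEq, Fin.ext_iff, Fin.val_castSucc,
      Fin.val_succ, ne_eq, true_and] at *
    split_ifs <;> first | omega | decide

lemma vertexSum_single_boundary {n : ℕ} {i : Fin n} {k : Fin (n + 1)} {v : Fin n × Fin n}
    (hk : k = 0 ∨ k = Fin.last n) (hv : EdgeIncident (Edge.vert i k) v) (u : Fin n × Fin n) :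
    vertexSum (Pi.single (Edge.vert i k) 1) u = if u = v then 1 else 0 := by
  obtain ⟨a, b⟩ := u
  obtain ⟨i', j⟩ := v
  obtain ⟨rfl, hv⟩ := hv
  simp only [vertexSum, leftE, rightE, botE, topE, Pi.single_apply, Edge.vert.injEq,
    reduceCtorEq, if_false, zero_add, Prod.mk.injEq, Fin.ext_iff, Fin.val_castSucc,
    Fin.val_succ, Fin.val_zero, Fin.val_last] at *
  split_ifs <;> first | omega | decide

/-- `c` is a red mod-2 chain avoiding the left and right boundary edges and using an odd number
of bottom boundary edges. -/
structure IsRedBottomChain {n : ℕ} (τ : EdgeConfig n) (c : Edge n → ZMod 2) : Prop where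
  green : ∀ e, greenB τ e = true → c e = 0
  left : ∀ j, c (Edge.horiz 0 j) = 0
  right : ∀ j, c (Edge.horiz (Fin.last n) j) = 0
  bottom : ∑ i, c (Edge.vert i 0) = 1

lemma IsRedBottomChain.add_single {n : ℕ} {τ : EdgeConfig n} {c : Edge n → ZMod 2}
    (hc : IsRedBottomChain τ c) {e : Edge n} (he : greenB τ e = false)
    (hl : ∀ j, e ≠ Edge.horiz 0 j) (hr : ∀ j, e ≠ Edge.horiz (Fin.last n) j)
    (hb : ∀ i, e ≠ Edge.vert i 0) : IsRedBottomChain τ (c + Pi.single e 1) where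
  green f hf := by
    have : f ≠ e := by rintro rfl; simp_all
    simp [hc.green f hf, this]
  left j := by simp [hc.left, (hl j).symm]
  right j := by simp [hc.right, (hr j).symm]
  bottom := by
    rw [← hc.bottom]
    exact Finset.sum_congr rfl fun i _ => by simp [(hb i).symm]

/-- A red path down to the bottom boundary yields, for each vertex `v` of its first edge, a red
mod-2 chain from `v` to the bottom boundary. -/
lemma exists_redBottomChain {n : ℕ} {τ : EdgeConfig n} {i₀ : Fin n} :
    ∀ (p : List (Edge n)) (e : Edge n), List.IsChain EdgeAdj (e :: p) →
      (∀ f ∈ e :: p, greenB τ f = false) →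
      (e :: p).getLast? = some (Edge.vert i₀ 0) → ∀ v, EdgeIncident e v →
      ∃ c, IsRedBottomChain τ c ∧ ∀ u, vertexSum c u = if u = v then 1 else 0
  | [], e, _, hred, hlast, v, hv => by
    obtain rfl : e = Edge.vert i₀ 0 := by simpa using hlast
    refine ⟨Pi.single (Edge.vert i₀ 0) 1, ⟨fun f hf => ?_, by simp, by simp, ?_⟩,
      vertexSum_single_boundary (.inl rfl) hv⟩
    · have : f ≠ Edge.vert i₀ 0 := by rintro rfl; simp_all
      simp [this]
    · simp [Pi.single_apply]
  | e' :: p, e, hp, hred, hlast, v, hv => by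
    rw [List.isChain_cons_cons] at hp
    obtain ⟨⟨-, w, hew, he'w⟩, hp⟩ := hp
    obtain ⟨c, hc, hcw⟩ := exists_redBottomChain p e' hp
      (fun f hf => hred f (List.mem_cons_of_mem _ hf)) (by simpa using hlast) w he'w
    by_cases hvw : v = w
    · exact ⟨c, hc, by simpa [hvw] using hcw⟩
    have hinner : (∀ j, e ≠ Edge.horiz 0 j) ∧ (∀ j, e ≠ Edge.horiz (Fin.last n) j) ∧
        ∀ i, e ≠ Edge.vert i 0 := by
      obtain ⟨i, j⟩ := v
      obtain ⟨i', j'⟩ := w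
      refine ⟨?_, ?_, ?_⟩ <;> rintro k rfl <;>
        simp only [EdgeIncident, Prod.mk.injEq, Fin.ext_iff, Fin.val_castSucc, Fin.val_succ,
          Fin.val_zero, Fin.val_last] at * <;> omega
    refine ⟨_, hc.add_single (hred e (by simp)) hinner.1 hinner.2.1 hinner.2.2, fun u => ?_⟩
    rw [vertexSum_add, hcw, vertexSum_single hv hew hvw, add_comm, add_assoc,
      CharTwo.add_self_eq_zero, add_zero]

/-- A red vertical bridge yields a red mod-2 cycle relative to the top and bottom boundaries. -/
lemma VertRedBridge.exists_chain {n : ℕ} {τ : EdgeConfig n} (h : VertRedBridge τ) :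
    ∃ c, IsRedBottomChain τ c ∧ ∀ u, vertexSum c u = 0 := by
  obtain ⟨p, ⟨hne, -, hp, hred⟩, ⟨i, hi⟩, ⟨i₀, hi₀⟩⟩ := h
  cases p with
  | nil => exact absurd rfl hne
  | cons e p =>
    obtain rfl : e = Edge.vert i (Fin.last n) := by simpa using hi
    have hpos : n ≠ 0 := by have := i.isLt; omega
    have hv : EdgeIncident (Edge.vert i (Fin.last n)) (i, ⟨n - 1, by omega⟩) := by
      refine ⟨rfl, .inr (Fin.ext ?_)⟩
      simp only [Fin.val_last, Fin.val_succ]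
      omega
    obtain ⟨c, hc, hcv⟩ := exists_redBottomChain p _ hp hred hi₀ _ hv
    refine ⟨_, hc.add_single (hred (Edge.vert i (Fin.last n)) (by simp)) (by simp) (by simp) ?_,
      fun u => ?_⟩
    · simp [Fin.ext_iff, hpos]
    · rw [vertexSum_add, hcv, vertexSum_single_boundary (.inr rfl) hv,
        CharTwo.add_self_eq_zero]

/-- The parity of the crossings of `c` with the horizontal ray to the left of the face `(k, b)`. -/
def crossingParity {n : ℕ} (c : Edge n → ZMod 2) (k b : Fin (n + 1)) : ZMod 2 :=
  Fin.partialSum (fun i => c (Edge.vert i b)) k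

lemma crossingParity_zero {n : ℕ} (c : Edge n → ZMod 2) (b : Fin (n + 1)) :
    crossingParity c 0 b = 0 := Fin.partialSum_zero _

lemma crossingParity_succ {n : ℕ} (c : Edge n → ZMod 2) (i : Fin n) (b : Fin (n + 1)) :
    crossingParity c i.succ b = crossingParity c i.castSucc b + c (Edge.vert i b) :=
  Fin.partialSum_succ _ _

lemma crossingParity_up {n : ℕ} {c : Edge n → ZMod 2} (hleft : ∀ j, c (Edge.horiz 0 j) = 0)
    (hsum : ∀ u, vertexSum c u = 0) (k : Fin (n + 1)) (j : Fin n) :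
    crossingParity c k j.succ = crossingParity c k j.castSucc + c (Edge.horiz k j) := by
  induction k using Fin.induction with
  | zero => simp [crossingParity_zero, hleft]
  | succ i ih =>
    have h := hsum (i, j)
    simp only [vertexSum, leftE, rightE, botE, topE] at h
    rw [crossingParity_succ, crossingParity_succ, ih]
    generalize c (Edge.horiz i.castSucc j) = l at *
    generalize c (Edge.horiz i.succ j) = r at *
    generalize c (Edge.vert i j.castSucc) = b at *
    generalize c (Edge.vert i j.succ) = t at *
    generalize crossingParity c i.castSucc j.castSucc = a
    revert h
    clear ih
    revert l r b t a
    decide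

lemma crossingParity_last {n : ℕ} {τ : EdgeConfig n} {c : Edge n → ZMod 2}
    (hc : IsRedBottomChain τ c) (hsum : ∀ u, vertexSum c u = 0) (b : Fin (n + 1)) :
    crossingParity c (Fin.last n) b = 1 := by
  induction b using Fin.induction with
  | zero => simpa [crossingParity, Fin.partialSum, List.take_of_length_le, List.sum_ofFn]
      using hc.bottom
  | succ j ih => rw [crossingParity_up hc.left hsum, ih, hc.right, add_zero]

/-- The crossing parity of the face to the left of a vertical edge or below a horizontal one. -/
def edgeSide {n : ℕ} (c : Edge n → ZMod 2) : Edge n → ZMod 2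
  | Edge.horiz k j => crossingParity c k j.castSucc
  | Edge.vert i b => crossingParity c i.castSucc b

lemma EdgeIncident.cases {n : ℕ} {e : Edge n} {i j : Fin n} (h : EdgeIncident e (i, j)) :
    e = leftE i j ∨ e = rightE i j ∨ e = botE i j ∨ e = topE i j := by
  cases e <;> simp_all [EdgeIncident, leftE, rightE, botE, topE]

/-- In terms of colours, the ice rule says that a vertex has as many green horizontal edges as
green vertical ones. -/
lemma IceRule.green_balance {n : ℕ} {τ : EdgeConfig n} (hτ : IceRule τ) (i j : Fin n) :
    (greenB τ (leftE i j)).toNat + (greenB τ (rightE i j)).toNat =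
      (greenB τ (botE i j)).toNat + (greenB τ (topE i j)).toNat := by
  have h := hτ i j
  simp only [inDegree] at h
  simp only [greenB, leftE, rightE, botE, topE, greenOrient, Fin.val_castSucc,
    Fin.val_succ] at h ⊢
  rw [show i.val + 1 + j.val = i.val + j.val + 1 by ring,
    show i.val + (j.val + 1) = i.val + j.val + 1 by ring, Nat.add_mod _ 1]
  revert h
  generalize τ (Edge.horiz i.castSucc j) = l
  generalize τ (Edge.horiz i.succ j) = r
  generalize τ (Edge.vert i j.castSucc) = b
  generalize τ (Edge.vert i j.succ) = t
  rcases Nat.mod_two_eq_zero_or_one (i.val + j.val) with hm | hm <;> rw [hm] <;>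
    revert l r b t <;> decide

lemma edgeSide_eq_of_adj {n : ℕ} {τ : EdgeConfig n} (hτ : IceRule τ) {c : Edge n → ZMod 2}
    (hc : IsRedBottomChain τ c) (hsum : ∀ u, vertexSum c u = 0) {e f : Edge n}
    (he : greenB τ e = true) (hf : greenB τ f = true) (hef : EdgeAdj e f) :
    edgeSide c e = edgeSide c f := by
  obtain ⟨-, ⟨i, j⟩, hei, hfi⟩ := hef
  have hr : edgeSide c (rightE i j) = edgeSide c (leftE i j) + c (botE i j) :=
    crossingParity_succ c i j.castSucc
  have ht : edgeSide c (topE i j) = edgeSide c (leftE i j) + c (leftE i j) :=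
    crossingParity_up hc.left hsum i.castSucc j
  have hb : edgeSide c (botE i j) = edgeSide c (leftE i j) := rfl
  have hs := hsum (i, j)
  have hice := hτ.green_balance i j
  have hl' := hc.green (leftE i j)
  have hr' := hc.green (rightE i j)
  have hb' := hc.green (botE i j)
  have ht' := hc.green (topE i j)
  have hlb : c (leftE i j) + c (botE i j) = 0 → c (leftE i j) = c (botE i j) :=
    CharTwo.add_eq_zero.mp
  simp only [vertexSum] at hs
  rcases hei.cases with rfl | rfl | rfl | rfl <;> rcases hfi.cases with rfl | rfl | rfl | rfl <;>
    cases hgl : greenB τ (leftE i j) <;> cases hgr : greenB τ (rightE i j) <;>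
    cases hgb : greenB τ (botE i j) <;> cases hgt : greenB τ (topE i j) <;> simp_all

/-- a green horizontal bridge precludes a red vertical bridge. -/
theorem horiz_green_bridge_no_vert_red_bridge (n : ℕ) (hn : 1 ≤ n)
    (τ : EdgeConfig n) (hτ : τ ∈ OmegaSet n) (h : HorizGreenBridge τ) :
    ¬ VertRedBridge τ := by
  intro hred
  obtain ⟨c, hc, hsum⟩ := hred.exists_chain
  obtain ⟨p, ⟨-, -, hp, hgreen⟩, ⟨j, hj⟩, ⟨j', hj'⟩⟩ := h
  have hside : ∀ e ∈ p, edgeSide c e = 0 := by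
    have hp' : p.IsChain fun e f => edgeSide c e = 0 → edgeSide c f = 0 :=
      List.IsChain.imp_of_mem_imp (fun e f he hf hef h => by
        rw [← edgeSide_eq_of_adj hτ hc hsum (hgreen e he) (hgreen f hf) hef, h]) hp
    refine List.IsChain.induction _ p hp' (fun _ _ h => h) fun hne => ?_
    rw [List.head?_eq_some_head hne, Option.some.injEq] at hj
    rw [hj]
    exact crossingParity_zero c _
  have hlast := hside _ (List.mem_of_getLast? hj')
  rw [edgeSide, crossingParity_last hc hsum] at hlast
  exact one_ne_zero hlast
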